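/- For every n ≥ 1, 4 rₙ = β − α − 2n − (α + β + 2n + 2) aₙ. -/

import Mathlib

open MeasureTheory Polynomial

/-- The Jacobi moment functional. -/
noncomputable def jacL (α β : ℝ) (q : Polynomial ℝ) : ℝ :=
  ∫ x in (-1 : ℝ)..1, q.eval x * ((1 - x) ^ α * (1 + x) ^ β)

lemma jac_cont (α β : ℝ) (hα : 0 ≤ α) (hβ : 0 ≤ β) (q : Polynomial ℝ) :
    Continuous (fun x : ℝ => q.eval x * ((1 - x) ^ α * (1 + x) ^ β)) := by
  have h1 : Continuous (fun x : ℝ => (1 - x) ^ α) :=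
    (continuous_const.sub continuous_id).rpow_const (fun _ => Or.inr hα)
  have h2 : Continuous (fun x : ℝ => (1 + x) ^ β) :=
    (continuous_const.add continuous_id).rpow_const (fun _ => Or.inr hβ)
  exact q.continuous.mul (h1.mul h2)

lemma jac_int (α β : ℝ) (hα : 0 ≤ α) (hβ : -1 < β) (q : Polynomial ℝ) :
    IntervalIntegrable (fun x : ℝ => q.eval x * ((1 - x) ^ α * (1 + x) ^ β)) volume (-1) 1 := by
  have h1 : Continuous (fun x : ℝ => (1 - x) ^ α) :=
    (continuous_const.sub continuous_id).rpow_const (fun _ => Or.inr hα)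
  have h2 : IntervalIntegrable (fun x : ℝ => (1 + x) ^ β) volume (-1) 1 := by
    have := (intervalIntegral.intervalIntegrable_rpow' (a := 0) (b := 2) hβ).comp_add_left (c := 1)
    norm_num at this
    exact this
  have := h2.continuousOn_mul (q.continuous.mul h1).continuousOn
  refine this.congr ?_
  intro x _
  simp only [Pi.mul_apply]
  ring

lemma jacL_add (α β : ℝ) (hα : 0 ≤ α) (hβ : -1 < β) (p q : Polynomial ℝ) :
    jacL α β (p + q) = jacL α β p + jacL α β q := by
  unfold jacL
  rw [← intervalIntegral.integral_add (jac_int α β hα hβ p) (jac_int α β hα hβ q)]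
  congr 1; ext x; simp; ring

lemma jacL_smul (α β : ℝ) (c : ℝ) (p : Polynomial ℝ) :
    jacL α β (C c * p) = c * jacL α β p := by
  unfold jacL
  rw [← intervalIntegral.integral_const_mul]
  congr 1; ext x; simp; ring

lemma jacL_mul_one_add (α β : ℝ) (q : Polynomial ℝ) :
    jacL α (β - 1) ((1 + X) * q) = jacL α β q := by
  unfold jacL
  apply intervalIntegral.integral_congr_ae
  refine Filter.Eventually.of_forall fun x hx => ?_
  rw [Set.uIoc_of_le (by norm_num)] at hx
  have h0 : 0 < 1 + x := by linarith [hx.1]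
  have : (1 + x) ^ β = (1 + x) ^ (β - 1) * (1 + x) := by
    rw [← Real.rpow_add_one h0.ne']; congr 1; ring
  rw [this]; simp; ring

lemma jac_ibp (α β : ℝ) (hα : 0 < α) (hβ : 0 < β) (q : Polynomial ℝ) :
    2 * β * jacL α (β - 1) q =
      (1 + α + β) * jacL α β q - jacL α β ((1 - X) * derivative q) := by
  have hb : -1 < β - 1 := by linarith
  set D : Polynomial ℝ := (1 + X) * ((1 - X) * derivative q)
    + (C (-(1 + α + β)) * ((1 + X) * q) + C (2 * β) * q) with hD
  have key : jacL α (β - 1) D = 0 := by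
    unfold jacL
    rw [intervalIntegral.integral_eq_sub_of_hasDerivAt_of_le
      (f := fun x => q.eval x * ((1 - x) ^ (α + 1) * (1 + x) ^ β)) (by norm_num)
      (jac_cont (α + 1) β (by linarith) hβ.le q).continuousOn ?_ (jac_int α (β - 1) hα.le hb D)]
    · norm_num [Real.zero_rpow hβ.ne', Real.zero_rpow (by linarith : α + 1 ≠ 0)]
    · intro x hx
      have h1 : 0 < 1 - x := by linarith [hx.2]
      have h2 : 0 < 1 + x := by linarith [hx.1]
      have d1 : HasDerivAt (fun x : ℝ => (1 - x) ^ (α + 1)) (-1 * (α + 1) * (1 - x) ^ (α + 1 - 1)) x :=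
        ((hasDerivAt_id x).const_sub 1).rpow_const (Or.inl h1.ne')
      have d2 : HasDerivAt (fun x : ℝ => (1 + x) ^ β) (1 * β * (1 + x) ^ (β - 1)) x :=
        ((hasDerivAt_id x).const_add 1).rpow_const (Or.inl h2.ne')
      have := (q.hasDerivAt x).mul (d1.mul d2)
      refine this.congr_deriv ?_
      have e1 : (1 + x) ^ β = (1 + x) ^ (β - 1) * (1 + x) := by
        rw [← Real.rpow_add_one h2.ne']; congr 1; ring
      have e2 : (1 - x) ^ (α + 1) = (1 - x) ^ α * (1 - x) := Real.rpow_add_one h1.ne' α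
      simp only [Pi.mul_apply]
      rw [e1, e2, add_sub_cancel_right, hD]
      simp
      ring
  rw [hD, jacL_add _ _ hα.le hb, jacL_add _ _ hα.le hb, jacL_smul, jacL_smul,
    jacL_mul_one_add, jacL_mul_one_add] at key
  linarith

lemma jac_orth (α β : ℝ) (hα : 0 < α) (hβ : 0 < β) (P : ℕ → Polynomial ℝ)
    (hmonic : ∀ n, (P n).Monic) (hdeg : ∀ n, (P n).natDegree = n)
    (horth : ∀ m n : ℕ, m ≠ n → jacL α β (P m * P n) = 0) :
    ∀ (k : ℕ) (q : Polynomial ℝ), (∀ j, k ≤ j → q.coeff j = 0) → ∀ n, k ≤ n →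
      jacL α β (q * P n) = 0 := by
  intro k
  induction k with
  | zero =>
    intro q hq n _
    have : q = 0 := by ext j; simp [hq j (Nat.zero_le _)]
    simp [this, jacL]
  | succ k ih =>
    intro q hq n hn
    have hk : (P k).coeff k = 1 := by
      have := hmonic k; rw [Monic, leadingCoeff, hdeg] at this; exact this
    have e : q * P n = (q - C (q.coeff k) * P k) * P n + C (q.coeff k) * (P k * P n) := by ring
    rw [e, jacL_add _ _ hα.le (by linarith), jacL_smul, horth k n (by omega), ih _ ?_ n (by omega)]
    · simp
    · intro j hj
      rcases hj.eq_or_lt with rfl | hj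
      · simp [hk]
      · rw [coeff_sub, coeff_C_mul, hq j hj, coeff_eq_zero_of_natDegree_lt (p := P _) (by rw [hdeg]; exact hj)]
        simp

lemma jac_proj (α β : ℝ) (hα : 0 < α) (hβ : 0 < β) (P : ℕ → Polynomial ℝ)
    (hmonic : ∀ n, (P n).Monic) (hdeg : ∀ n, (P n).natDegree = n)
    (horth : ∀ m n : ℕ, m ≠ n → jacL α β (P m * P n) = 0)
    (n : ℕ) (q : Polynomial ℝ) (hq : ∀ j, n < j → q.coeff j = 0) :
    jacL α β (q * P n) = q.coeff n * jacL α β (P n * P n) := by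
  have hk : (P n).coeff n = 1 := by
    have := hmonic n; rw [Monic, leadingCoeff, hdeg] at this; exact this
  have e : q * P n = (q - C (q.coeff n) * P n) * P n + C (q.coeff n) * (P n * P n) := by ring
  rw [e, jacL_add _ _ hα.le (by linarith), jacL_smul,
    jac_orth α β hα hβ P hmonic hdeg horth n _ ?_ n le_rfl]
  · simp
  · intro j hj
    rcases hj.eq_or_lt with rfl | hj
    · simp [hk]
    · rw [coeff_sub, coeff_C_mul, hq j hj, coeff_eq_zero_of_natDegree_lt (p := P _) (by rw [hdeg]; exact hj)]
      simp

lemma jac_pos (α β : ℝ) (hα : 0 < α) (hβ : 0 < β) (p : Polynomial ℝ) (hp : p ≠ 0) :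
    0 < jacL α β (p * p) := by
  unfold jacL
  apply intervalIntegral.integral_pos (by norm_num) (jac_cont α β hα.le hβ.le _).continuousOn
  · intro x hx
    have h1 : 0 ≤ 1 - x := by linarith [hx.2]
    have h2 : 0 ≤ 1 + x := by linarith [hx.1]
    rw [eval_mul]
    have := mul_self_nonneg (p.eval x)
    positivity
  · have hinf : (Set.Ioo (-1 : ℝ) 1).Infinite := Set.Ioo_infinite (by norm_num)
    obtain ⟨c, hc, hcr⟩ := hinf.exists_notMem_finset p.roots.toFinset
    have hne : p.eval c ≠ 0 := by
      intro h0; apply hcr; simp [hp, h0]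
    refine ⟨c, Set.Ioo_subset_Icc_self hc, ?_⟩
    have h1 : 0 < 1 - c := by linarith [hc.2]
    have h2 : 0 < 1 + c := by linarith [hc.1]
    rw [eval_mul]
    have := mul_self_pos.2 hne
    positivity

/-- for every `n ≥ 1`, `4 rₙ = β - α - 2n - (α + β + 2n + 2) aₙ`. -/
theorem jacobi_rn_value
    (α β : ℝ) (hα : 0 < α) (hβ : 0 < β)
    (P : ℕ → Polynomial ℝ)
    (hmonic : ∀ n, (P n).Monic) (hdeg : ∀ n, (P n).natDegree = n)
    (horth : ∀ m n : ℕ, m ≠ n →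
      ∫ x in (-1 : ℝ)..1, (P m).eval x * (P n).eval x * ((1 - x) ^ α * (1 + x) ^ β) = 0)
    (h : ℕ → ℝ)
    (hh : ∀ n, h n = ∫ x in (-1 : ℝ)..1, ((P n).eval x) ^ 2 * ((1 - x) ^ α * (1 + x) ^ β))
    (a b : ℕ → ℝ)
    (hrec : ∀ n : ℕ, 1 ≤ n → ∀ x : ℝ,
      x * (P n).eval x = (P (n + 1)).eval x + a n * (P n).eval x + b n * (P (n - 1)).eval x)
    (r : ℕ → ℝ)
    (hr : ∀ n : ℕ, 1 ≤ n → r n =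
      (β / h (n - 1)) * ∫ y in (-1 : ℝ)..1,
        (P n).eval y * (P (n - 1)).eval y * ((1 - y) ^ α * (1 + y) ^ (β - 1))) :
    ∀ n : ℕ, 1 ≤ n →
      4 * r n = β - α - 2 * (n : ℝ) - (α + β + 2 * (n : ℝ) + 2) * a n := by
  have hL : ∀ m n : ℕ, m ≠ n → jacL α β (P m * P n) = 0 := by
    intro m n hmn
    have := horth m n hmn
    simpa [jacL] using this
  have hhL : ∀ n, h n = jacL α β (P n * P n) := by
    intro n; rw [hh]; simp [jacL, pow_two]
  have hlc : ∀ n, (P n).coeff n = 1 := by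
    intro n
    have := hmonic n; rw [Monic, leadingCoeff, hdeg] at this; exact this
  have hz : ∀ n j, n < j → (P n).coeff j = 0 := by
    intro n j hj
    exact coeff_eq_zero_of_natDegree_lt (by rw [hdeg]; exact hj)
  have hb1 : -1 < β := by linarith
  have proj := jac_proj α β hα hβ P hmonic hdeg hL
  have orth := jac_orth α β hα hβ P hmonic hdeg hL
  have hLadd := jacL_add α β hα.le hb1
  have smul := jacL_smul α β
  intro n hn
  obtain ⟨m, rfl⟩ : ∃ m, n = m + 1 := ⟨n - 1, by omega⟩
  have hpos : ∀ k, 0 < h k := fun k => by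
    rw [hhL]; exact jac_pos α β hα hβ _ (hmonic k).ne_zero
  set p := (P (m + 1)).coeff m with hp
  set s := (P (m + 2)).coeff (m + 1) with hs
  -- recurrence as a polynomial identity
  have hX : X * P (m + 1) = P (m + 2) + C (a (m + 1)) * P (m + 1) + C (b (m + 1)) * P m := by
    apply Polynomial.funext
    intro x
    have := hrec (m + 1) hn x
    simpa using this
  have hps : p = s + a (m + 1) := by
    have := congrArg (fun q => q.coeff (m + 1)) hX
    simp only [coeff_X_mul, coeff_add, coeff_C_mul, hlc, hz m (m + 1) (by omega)] at this
    linarith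
  -- first relation
  have rel1 : 2 * r (m + 1) = -((m : ℝ) + 1) - p := by
    have ibp := jac_ibp α β hα hβ (P (m + 1) * P m)
    have hr' : r (m + 1) = β / h m * jacL α (β - 1) (P (m + 1) * P m) := by
      rw [hr (m + 1) hn]; simp [jacL]
    have e : (1 - X) * derivative (P (m + 1) * P m)
        = derivative (P (m + 1)) * P m
          + (C (-1) * ((X * derivative (P (m + 1)) + C (-((m : ℝ) + 1)) * P (m + 1)) * P m)
          + (C (-((m : ℝ) + 1)) * (P (m + 1) * P m)
          + ((1 - X) * derivative (P m)) * P (m + 1))) := by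
      rw [derivative_mul]; simp only [map_neg, map_one, map_add]; ring
    rw [e, hLadd, hLadd, hLadd, smul, smul, hL (m + 1) m (by omega), proj m (derivative (P (m + 1))) ?_,
      proj m (X * derivative (P (m + 1)) + C (-((m : ℝ) + 1)) * P (m + 1)) ?_,
      orth (m + 1) ((1 - X) * derivative (P m)) ?_ (m + 1) le_rfl, ← hhL] at ibp
    · have c1 : (derivative (P (m + 1))).coeff m = m + 1 := by
        rw [coeff_derivative, hlc]; ring
      have c2 : (X * derivative (P (m + 1)) + C (-((m : ℝ) + 1)) * P (m + 1)).coeff m = -p := by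
        rw [coeff_add, coeff_C_mul]
        rcases m with _ | k
        · simp [hp]
        · rw [coeff_X_mul, coeff_derivative]; push_cast; ring
      rw [c1, c2] at ibp
      rw [hr']
      have := (hpos m).ne'
      field_simp
      linarith
    · intro j hj
      obtain ⟨k, rfl⟩ : ∃ k, j = k + 1 := ⟨j - 1, by omega⟩
      rw [sub_mul, one_mul, coeff_sub, coeff_X_mul, coeff_derivative, coeff_derivative,
        hz m _ (by omega), hz m _ (by omega)]; simp
    · intro j hj
      obtain ⟨k, rfl⟩ : ∃ k, j = k + 1 := ⟨j - 1, by omega⟩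
      rw [coeff_add, coeff_C_mul, coeff_X_mul, coeff_derivative]
      rcases (Nat.succ_le_of_lt hj).eq_or_lt with h1 | h1
      · obtain rfl : m = k := by omega
        rw [hlc]; ring
      · rw [hz _ _ (by omega)]; simp
    · intro j hj
      rw [coeff_derivative, hz _ _ (by omega)]; simp
  -- second relation
  have rel2 : 2 * p - 2 * ((m : ℝ) + 1) * a (m + 1) + (β - α) - (α + β + 2) * a (m + 1) = 0 := by
    have ibp := jac_ibp α β hα hβ ((1 + X) * (P (m + 1) * P (m + 1)))
    rw [jacL_mul_one_add] at ibp
    have hx : jacL α β (X * (P (m + 1) * P (m + 1))) = a (m + 1) * h (m + 1) := by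
      rw [← mul_assoc, hX, add_mul, add_mul, mul_assoc, mul_assoc, hLadd, hLadd, smul, smul,
        hL (m + 2) (m + 1) (by omega), hL m (m + 1) (by omega), hhL]; ring
    have e1 : (1 + X) * (P (m + 1) * P (m + 1)) = P (m + 1) * P (m + 1) +
      X * (P (m + 1) * P (m + 1)) := by ring
    have e : (1 - X) * derivative ((1 + X) * (P (m + 1) * P (m + 1)))
        = P (m + 1) * P (m + 1) + (C (-1) * (X * (P (m + 1) * P (m + 1)))
          + (C 2 * (derivative (P (m + 1)) * P (m + 1))
          + (C (-2) * ((X * (X * derivative (P (m + 1))) + C (-((m : ℝ) + 1)) * P (m + 2)) * P (m + 1))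
          + C (-2 * ((m : ℝ) + 1)) * (P (m + 2) * P (m + 1))))) := by
      simp only [derivative_mul, derivative_add, derivative_one, derivative_X, map_neg, map_one,
        map_add, map_mul, show (C (2 : ℝ)) = 2 from rfl]
      ring
    rw [e, e1, hLadd, hLadd, hLadd, hLadd, hLadd, smul, smul, smul, smul, hx, hL (m + 2) (m + 1) (by omega),
      orth (m + 1) (derivative (P (m + 1))) ?_ (m + 1) le_rfl,
      proj (m + 1) (X * (X * derivative (P (m + 1))) + C (-((m : ℝ) + 1)) * P (m + 2)) ?_,
      ← hhL] at ibp
    · have c2 : (X * (X * derivative (P (m + 1))) + C (-((m : ℝ) + 1)) * P (m + 2)).coeff (m + 1)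
          = m * p - (m + 1) * s := by
        rw [coeff_add, coeff_C_mul, coeff_X_mul]
        rcases m with _ | k
        · simp [hs]
        · rw [coeff_X_mul, coeff_derivative]; push_cast; ring
      rw [c2] at ibp
      apply mul_right_cancel₀ (hpos (m + 1)).ne'
      rw [hps] at ibp ⊢
      linear_combination ibp
    · intro j hj
      obtain ⟨k, rfl⟩ : ∃ k, j = k + 2 := ⟨j - 2, by omega⟩
      rw [coeff_add, coeff_C_mul, coeff_X_mul, coeff_X_mul, coeff_derivative]
      rcases (Nat.succ_le_of_lt hj).eq_or_lt with h1 | h1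
      · obtain rfl : m = k := by omega
        rw [hlc, hlc]; ring
      · rw [hz _ _ (by omega), hz _ _ (by omega)]; simp
    · intro j hj
      rw [coeff_derivative, hz _ _ (by omega)]; simp
  push_cast
  linear_combination 2 * rel1 - rel2
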